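/- Let u, v ∈ ℝ⁸ be orthonormal vectors (|u| = |v| = 1, ⟨u,v⟩ = 0). Then for every z ∈ ℝ⁸ with z ⊥ u and z ⊥ v, the vector J_{u,v}(z) is orthogonal to both u and v, satisfies |J_{u,v}(z)| = |z|, and J_{u,v}(J_{u,v}(z)) = −z. In particular, J_{u,v} restricts to an orthogonal complex structure on the 6-dimensional orthogonal complement of span{u, v} in ℝ⁸. -/

import Mathlib

noncomputable section
open scoped RealInnerProductSpace

/-- Euclidean 8-space ℝ⁸. -/
abbrev E8 : Type := EuclideanSpace ℝ (Fin 8)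

/-- The alternating 4-form `dx^i ∧ dx^j ∧ dx^k ∧ dx^l` on ℝ⁸, evaluated on four vectors. -/
def dx4 (i j k l : Fin 8) (v : Fin 4 → E8) : ℝ :=
  Matrix.det (Matrix.of fun a b => v b (![i, j, k, l] a))

/-- The Cayley 4-form `Φ₀` on ℝ⁸ (indices written 0-based, i.e. `dx4 0 1 2 3` is `dx¹²³⁴`). -/
def Phi0 (v : Fin 4 → E8) : ℝ :=
  dx4 0 1 2 3 v + dx4 0 1 4 5 v + dx4 0 1 6 7 v + dx4 0 2 4 6 v
    - dx4 0 2 5 7 v - dx4 0 3 4 7 v - dx4 0 3 5 6 v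
    - dx4 1 2 4 7 v - dx4 1 2 5 6 v - dx4 1 3 4 6 v
    + dx4 1 3 5 7 v + dx4 2 3 4 5 v + dx4 2 3 6 7 v + dx4 4 5 6 7 v

/-- The contraction of `Φ₀` with `z` and a bivector whose Plücker coordinates are `p i j`. -/
def cayleyContraction (p : Fin 8 → Fin 8 → ℝ) (z : E8) : E8 :=
  !₂[
    (-p 2 3 - p 4 5 - p 6 7) * z 1 + (p 1 3 - p 4 6 + p 5 7) * z 2 +
      (-p 1 2 + p 4 7 + p 5 6) * z 3 + (p 1 5 + p 2 6 - p 3 7) * z 4 +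
      (-p 1 4 - p 2 7 - p 3 6) * z 5 + (p 1 7 - p 2 4 + p 3 5) * z 6 +
      (-p 1 6 + p 2 5 + p 3 4) * z 7,
    (p 2 3 + p 4 5 + p 6 7) * z 0 + (-p 0 3 + p 4 7 + p 5 6) * z 2 +
      (p 0 2 + p 4 6 - p 5 7) * z 3 + (-p 0 5 - p 2 7 - p 3 6) * z 4 +
      (p 0 4 - p 2 6 + p 3 7) * z 5 + (-p 0 7 + p 2 5 + p 3 4) * z 6 +
      (p 0 6 + p 2 4 - p 3 5) * z 7,
    (-p 1 3 + p 4 6 - p 5 7) * z 0 + (p 0 3 - p 4 7 - p 5 6) * z 1 +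
      (-p 0 1 - p 4 5 - p 6 7) * z 3 + (-p 0 6 + p 1 7 + p 3 5) * z 4 +
      (p 0 7 + p 1 6 - p 3 4) * z 5 + (p 0 4 - p 1 5 + p 3 7) * z 6 +
      (-p 0 5 - p 1 4 - p 3 6) * z 7,
    (p 1 2 - p 4 7 - p 5 6) * z 0 + (-p 0 2 - p 4 6 + p 5 7) * z 1 +
      (p 0 1 + p 4 5 + p 6 7) * z 2 + (p 0 7 + p 1 6 - p 2 5) * z 4 +
      (p 0 6 - p 1 7 + p 2 4) * z 5 + (-p 0 5 - p 1 4 - p 2 7) * z 6 +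
      (-p 0 4 + p 1 5 + p 2 6) * z 7,
    (-p 1 5 - p 2 6 + p 3 7) * z 0 + (p 0 5 + p 2 7 + p 3 6) * z 1 +
      (p 0 6 - p 1 7 - p 3 5) * z 2 + (-p 0 7 - p 1 6 + p 2 5) * z 3 +
      (-p 0 1 - p 2 3 - p 6 7) * z 5 + (-p 0 2 + p 1 3 + p 5 7) * z 6 +
      (p 0 3 + p 1 2 - p 5 6) * z 7,
    (p 1 4 + p 2 7 + p 3 6) * z 0 + (-p 0 4 + p 2 6 - p 3 7) * z 1 +
      (-p 0 7 - p 1 6 + p 3 4) * z 2 + (-p 0 6 + p 1 7 - p 2 4) * z 3 +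
      (p 0 1 + p 2 3 + p 6 7) * z 4 + (p 0 3 + p 1 2 - p 4 7) * z 6 +
      (p 0 2 - p 1 3 + p 4 6) * z 7,
    (-p 1 7 + p 2 4 - p 3 5) * z 0 + (p 0 7 - p 2 5 - p 3 4) * z 1 +
      (-p 0 4 + p 1 5 - p 3 7) * z 2 + (p 0 5 + p 1 4 + p 2 7) * z 3 +
      (p 0 2 - p 1 3 - p 5 7) * z 4 + (-p 0 3 - p 1 2 + p 4 7) * z 5 +
      (-p 0 1 - p 2 3 - p 4 5) * z 7,
    (p 1 6 - p 2 5 - p 3 4) * z 0 + (-p 0 6 - p 2 4 + p 3 5) * z 1 +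
      (p 0 5 + p 1 4 + p 3 6) * z 2 + (p 0 4 - p 1 5 - p 2 6) * z 3 +
      (-p 0 3 - p 1 2 + p 5 6) * z 4 + (-p 0 2 + p 1 3 - p 4 6) * z 5 +
      (p 0 1 + p 2 3 + p 4 5) * z 6]

/-- The Plücker coordinates of `u ∧ v`. -/
def plucker (u v : E8) (i j : Fin 8) : ℝ := u i * v j - v i * u j

lemma dx4_eq (i j k l : Fin 8) (u v z w : E8) :
    dx4 i j k l ![u, v, z, w] =
      plucker u v i j * plucker z w k l - plucker u v i k * plucker z w j l
        + plucker u v i l * plucker z w j k + plucker u v j k * plucker z w i l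
        - plucker u v j l * plucker z w i k + plucker u v k l * plucker z w i j := by
  simp [dx4, plucker, Matrix.det_succ_row_zero, Fin.sum_univ_succ, Fin.succAbove]
  ring

lemma inner_eq_sum_coords (x y : E8) :
    ⟪x, y⟫ = x 0 * y 0 + x 1 * y 1 + x 2 * y 2 + x 3 * y 3
      + x 4 * y 4 + x 5 * y 5 + x 6 * y 6 + x 7 * y 7 := by
  simp [PiLp.inner_apply, Fin.sum_univ_eight, mul_comm]

lemma inner_cayleyContraction (u v z w : E8) :
    ⟪cayleyContraction (plucker u v) z, w⟫ = Phi0 ![u, v, z, w] := by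
  simp only [Phi0, dx4_eq, inner_eq_sum_coords]
  simp [cayleyContraction]
  generalize plucker u v = p
  simp only [plucker]
  ring

lemma dx4_swap_last (i j k l : Fin 8) (u v z w : E8) :
    dx4 i j k l ![u, v, z, w] = -dx4 i j k l ![u, v, w, z] := by
  simp only [dx4_eq, plucker]
  ring

lemma Phi0_swap_last (u v z w : E8) : Phi0 ![u, v, z, w] = -Phi0 ![u, v, w, z] := by
  simp only [Phi0, dx4_swap_last _ _ _ _ u v z w]
  ring

lemma Phi0_self_first (u v z : E8) : Phi0 ![u, v, z, u] = 0 := by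
  simp only [Phi0, dx4_eq, plucker]
  ring

lemma Phi0_self_second (u v z : E8) : Phi0 ![u, v, z, v] = 0 := by
  simp only [Phi0, dx4_eq, plucker]
  ring

/-- The square of the contraction with `u ∧ v`, for arbitrary `u`, `v`, `z`. -/
lemma cayleyContraction_cayleyContraction (u v z : E8) :
    cayleyContraction (plucker u v) (cayleyContraction (plucker u v) z) =
      (⟪u, v⟫ ^ 2 - ⟪u, u⟫ * ⟪v, v⟫) • z
        + (⟪v, v⟫ * ⟪z, u⟫ - ⟪u, v⟫ * ⟪z, v⟫) • u
        + (⟪u, u⟫ * ⟪z, v⟫ - ⟪u, v⟫ * ⟪z, u⟫) • v := by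
  ext k
  simp only [inner_eq_sum_coords]
  fin_cases k <;>
  · simp [cayleyContraction, plucker]
    ring

/-- For orthonormal `u, v ∈ ℝ⁸`, the map `J_{u,v}` (defined by
`⟨J_{u,v} z, w⟩ = Φ₀(u,v,z,w)`) sends every vector `z` orthogonal to `u` and `v` to a
vector orthogonal to `u` and `v` of the same norm, and `J_{u,v}(J_{u,v} z) = -z`; i.e.
`J_{u,v}` restricts to an orthogonal complex structure on `(span{u,v})^⊥`. -/
theorem J_restricts_to_orthogonal_complex_structure (u v : E8)
    (hu : ‖u‖ = 1) (hv : ‖v‖ = 1) (huv : ⟪u, v⟫ = 0)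
    (J : E8 → E8) (hJ : ∀ z w : E8, ⟪J z, w⟫ = Phi0 ![u, v, z, w])
    (z : E8) (hzu : ⟪z, u⟫ = 0) (hzv : ⟪z, v⟫ = 0) :
    ⟪J z, u⟫ = 0 ∧ ⟪J z, v⟫ = 0 ∧ ‖J z‖ = ‖z‖ ∧ J (J z) = -z := by
  have hJ_eq (x : E8) : J x = cayleyContraction (plucker u v) x :=
    ext_inner_right ℝ fun w => by rw [hJ, inner_cayleyContraction]
  have hJJ : J (J z) = -z := by
    rw [hJ_eq, hJ_eq, cayleyContraction_cayleyContraction]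
    simp [hu, hv, huv, hzu, hzv]
  refine ⟨by rw [hJ, Phi0_self_first], by rw [hJ, Phi0_self_second], ?_, hJJ⟩
  have hsq : ⟪J z, J z⟫ = ⟪z, z⟫ := by
    rw [hJ, Phi0_swap_last, ← hJ, hJJ, inner_neg_left, neg_neg]
  rw [norm_eq_sqrt_real_inner, hsq, ← norm_eq_sqrt_real_inner]
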